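/- For almost every x ∈ (0,1), the approximation constants θ_n(x) have the limiting distribution F: for every z ∈ (0,1], lim_{n→∞} (1/n)·#{1 ≤ i ≤ n : θ_i(x) ≤ z} = F(z), where F(z) = z/log 2 for 0 < z ≤ 1/2 and F(z) = (1 − z + log(2z))/log 2 for 1/2 ≤ z ≤ 1. -/

import Mathlib

open Filter MeasureTheory Real Topology

/-- The Gauss map `x ↦ {1/x}`. -/
noncomputable def gaussMap (x : ℝ) : ℝ := Int.fract x⁻¹

/-- `partQuot x n` is the `n`-th partial quotient `aₙ` of the regular continued fraction
expansion `x = [a₁, a₂, …]` of `x ∈ (0,1)` (meaningful for `n ≥ 1`). -/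
noncomputable def partQuot (x : ℝ) (n : ℕ) : ℕ := (⌊(gaussMap^[n - 1] x)⁻¹⌋).toNat

/-- `cfQ x n` is the denominator `qₙ` of the `n`-th continued fraction convergent
`pₙ/qₙ = [a₁, …, aₙ]` of `x`, given by `q₀ = 1`, `q₁ = a₁`, `qₙ = aₙ qₙ₋₁ + qₙ₋₂`. -/
noncomputable def cfQ (x : ℝ) : ℕ → ℤ
  | 0 => 1
  | 1 => partQuot x 1
  | (n + 2) => partQuot x (n + 2) * cfQ x (n + 1) + cfQ x n

/-- `cfP x n` is the numerator `pₙ` of the `n`-th continued fraction convergent of `x`,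
given by `p₀ = 0`, `p₁ = 1`, `pₙ = aₙ pₙ₋₁ + pₙ₋₂`. -/
noncomputable def cfP (x : ℝ) : ℕ → ℤ
  | 0 => 0
  | 1 => 1
  | (n + 2) => partQuot x (n + 2) * cfP x (n + 1) + cfP x n


/-- The approximation constants `θₙ(x) = qₙ·|qₙ x − pₙ|`. -/
noncomputable def theta (x : ℝ) (n : ℕ) : ℝ :=
  (cfQ x n : ℝ) * |(cfQ x n : ℝ) * x - (cfP x n : ℝ)|



/-! ### Birkhoff's theorem for bounded functions -/

/-- Running maxima of Birkhoff sums. -/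
noncomputable def runMax {α : Type*} (T : α → α) (f : α → ℝ) : ℕ → α → ℝ
  | 0 => f
  | (n + 1) => fun x => f x + max 0 (runMax T f n (T x))

lemma runMax_succ {α : Type*} (T : α → α) (f : α → ℝ) (n : ℕ) (x : α) :
    runMax T f (n + 1) x = f x + max 0 (runMax T f n (T x)) := rfl

lemma runMax_mono {α : Type*} (T : α → α) (f : α → ℝ) (n : ℕ) (x : α) :
    runMax T f n x ≤ runMax T f (n + 1) x := by
  induction n generalizing x with
  | zero => simp [runMax]
  | succ n ih =>
    have := ih (T x)
    rw [runMax_succ T f n, runMax_succ T f (n + 1)]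
    gcongr

lemma birkhoffSum_le_runMax {α : Type*} (T : α → α) (f : α → ℝ) (n : ℕ) (x : α) :
    birkhoffSum T f (n + 1) x ≤ runMax T f n x := by
  induction n generalizing x with
  | zero => simp [runMax, birkhoffSum]
  | succ n ih =>
    rw [birkhoffSum_succ', runMax_succ]
    gcongr
    exact (ih (T x)).trans (le_max_right _ _)

lemma runMax_measurable {α : Type*} [MeasurableSpace α] {T : α → α} {f : α → ℝ}
    (hT : Measurable T) (hf : Measurable f) (n : ℕ) : Measurable (runMax T f n) := by
  induction n with
  | zero => exact hf
  | succ n ih => exact hf.add (measurable_const.max (ih.comp hT))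

lemma runMax_integrable {α : Type*} [MeasurableSpace α] {μ : Measure α} [IsProbabilityMeasure μ]
    {T : α → α} {f : α → ℝ}
    (hT : MeasurePreserving T μ μ) (hf : Integrable f μ) (n : ℕ) :
    Integrable (runMax T f n) μ := by
  induction n with
  | zero => exact hf
  | succ n ih =>
    exact hf.add ((integrable_const (0 : ℝ)).sup (hT.integrable_comp_of_integrable ih))

lemma birkhoff_bdd_above {α : Type*} [MeasurableSpace α] {μ : Measure α} [IsProbabilityMeasure μ]
    {T : α → α} {f : α → ℝ} (hT : Ergodic T μ) (hf : Measurable f) {C : ℝ}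
    (hC : ∀ x, |f x| ≤ C) (hneg : ∫ x, f x ∂μ < 0) :
    ∀ᵐ x ∂μ, ∃ B : ℝ, ∀ n, birkhoffSum T f (n + 1) x ≤ B := by
  have hTm := hT.toMeasurePreserving
  have hfi : Integrable f μ := Integrable.of_bound hf.aestronglyMeasurable C (ae_of_all _ hC)
  let E : Set α := {x | ∀ B : ℕ, ∃ n, (B : ℝ) ≤ runMax T f n x}
  have hE : MeasurableSet E := by
    have : E = ⋂ B : ℕ, ⋃ n, {x | (B : ℝ) ≤ runMax T f n x} := by ext; simp [E]
    rw [this]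
    exact MeasurableSet.iInter fun B => MeasurableSet.iUnion fun n =>
      measurableSet_le measurable_const (runMax_measurable hTm.measurable hf n)
  have hinv : T ⁻¹' E = E := by
    ext x
    constructor
    · intro h B
      obtain ⟨B', hB'⟩ := exists_nat_ge ((B : ℝ) + C)
      obtain ⟨n, hn⟩ := h B'
      refine ⟨n + 1, ?_⟩
      have h1 := (abs_le.1 (hC x)).1
      have h2 := le_max_right 0 (runMax T f n (T x))
      rw [runMax_succ]
      linarith
    · intro h B
      obtain ⟨B', hB'⟩ := exists_nat_ge ((B : ℝ) + C + 1)
      obtain ⟨n, hn⟩ := h B'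
      refine ⟨n, ?_⟩
      have h1 := (abs_le.1 (hC x)).2
      have h2 := hn.trans (runMax_mono T f n x)
      rw [runMax_succ] at h2
      have hB0 : (0 : ℝ) ≤ B := Nat.cast_nonneg B
      rcases le_total 0 (runMax T f n (T x)) with h3 | h3
      · rw [max_eq_right h3] at h2; linarith
      · rw [max_eq_left h3] at h2; linarith
  rcases hT.toPreErgodic.ae_mem_or_ae_notMem hE hinv with h | h
  · exfalso
    have hlim : Tendsto (fun n => ∫ x, (f x + max (-(runMax T f n (T x))) 0) ∂μ) atTop
        (𝓝 (∫ x, f x ∂μ)) := by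
      refine tendsto_integral_of_dominated_convergence (fun _ => C + C) ?_ (integrable_const _) ?_ ?_
      · intro n
        exact (hf.add (((runMax_measurable hTm.measurable hf n).comp
          hTm.measurable).neg.max measurable_const)).aestronglyMeasurable
      · intro n
        refine ae_of_all _ fun x => ?_
        refine (norm_add_le _ _).trans (add_le_add (hC x) ?_)
        rw [Real.norm_eq_abs, abs_of_nonneg (le_max_right _ _)]
        have h0 : runMax T f 0 (T x) ≤ runMax T f n (T x) :=
          (monotone_nat_of_le_succ (f := fun n => runMax T f n (T x))
            (fun n => runMax_mono T f n (T x))) (Nat.zero_le n)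
        have h1 := abs_le.1 (hC (T x))
        change f (T x) ≤ _ at h0
        exact max_le (by linarith) (by linarith)
      · filter_upwards [h] with x hx
        have hx' : T x ∈ E := by rw [← hinv] at hx; exact hx
        obtain ⟨N, hN⟩ := hx' 0
        refine tendsto_const_nhds.congr' ?_
        filter_upwards [eventually_ge_atTop N] with n hn
        have h0 : runMax T f N (T x) ≤ runMax T f n (T x) :=
          (monotone_nat_of_le_succ (f := fun n => runMax T f n (T x))
            (fun n => runMax_mono T f n (T x))) hn
        have h1 : 0 ≤ runMax T f n (T x) := by simpa using hN.trans h0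
        rw [max_eq_right (by linarith), add_zero]
    have hpos : ∀ n, 0 ≤ ∫ x, (f x + max (-(runMax T f n (T x))) 0) ∂μ := by
      intro n
      have hi1 := runMax_integrable hTm hfi (n + 1)
      have hi0 := runMax_integrable hTm hfi n
      have hiT : Integrable (fun x => runMax T f n (T x)) μ := hTm.integrable_comp_of_integrable hi0
      have e1 : ∀ x, f x + max (-(runMax T f n (T x))) 0
          = runMax T f (n + 1) x - runMax T f n (T x) := by
        intro x
        rw [runMax_succ]
        rcases le_total 0 (runMax T f n (T x)) with h3 | h3
        · rw [max_eq_right h3, max_eq_right (by linarith)]; ring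
        · rw [max_eq_left h3, max_eq_left (by linarith)]; ring
      simp_rw [e1]
      rw [integral_sub hi1 hiT]
      have e2 : ∫ x, runMax T f n (T x) ∂μ = ∫ x, runMax T f n x ∂μ := by
        have := integral_map (μ := μ) hTm.measurable.aemeasurable
          (f := runMax T f n) (runMax_measurable hTm.measurable hf n).aestronglyMeasurable
        rw [hTm.map_eq] at this
        exact this.symm
      rw [e2]
      have := integral_mono hi0 hi1 (runMax_mono T f n)
      linarith
    have := ge_of_tendsto' hlim hpos
    linarith
  · filter_upwards [h] with x hx
    simp only [E, Set.mem_ofPred_eq, not_forall, not_exists, not_le] at hx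
    obtain ⟨B, hB⟩ := hx
    exact ⟨B, fun n => (birkhoffSum_le_runMax T f n x).trans (hB n).le⟩

lemma birkhoff_upper {α : Type*} [MeasurableSpace α] {μ : Measure α} [IsProbabilityMeasure μ]
    {T : α → α} {f : α → ℝ} (hT : Ergodic T μ) (hf : Measurable f) {C : ℝ}
    (hC : ∀ x, |f x| ≤ C) :
    ∀ᵐ x ∂μ, ∀ ε : ℝ, 0 < ε → ∀ᶠ n : ℕ in atTop,
      birkhoffSum T f n x / n ≤ (∫ x, f x ∂μ) + ε := by
  have hfi : Integrable f μ := Integrable.of_bound hf.aestronglyMeasurable C (ae_of_all _ hC)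
  have key : ∀ᵐ x ∂μ, ∀ k : ℕ, ∃ B : ℝ, ∀ n,
      birkhoffSum T (fun y => f y - (∫ x, f x ∂μ) - 1 / ((k : ℝ) + 1)) (n + 1) x ≤ B := by
    rw [ae_all_iff]
    intro k
    refine birkhoff_bdd_above hT ((hf.sub measurable_const).sub measurable_const)
      (C := C + |∫ x, f x ∂μ| + |1 / ((k : ℝ) + 1)|) ?_ ?_
    · intro x
      refine (abs_sub _ _).trans (add_le_add_left ((abs_sub _ _).trans
        (add_le_add_left (hC x) _)) _)
    · simp_rw [sub_sub]
      rw [integral_sub hfi (integrable_const _)]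
      simp
      positivity
  filter_upwards [key] with x hx ε hε
  obtain ⟨k, hk⟩ := exists_nat_one_div_lt (half_pos hε)
  obtain ⟨B, hB⟩ := hx k
  obtain ⟨N, hN⟩ := exists_nat_ge (B / (ε / 2))
  filter_upwards [eventually_ge_atTop (N + 1)] with n hn
  obtain ⟨m, rfl⟩ : ∃ m, n = m + 1 := ⟨n - 1, by omega⟩
  have h1 := hB m
  have h2 : birkhoffSum T (fun y => f y - (∫ x, f x ∂μ) - 1 / ((k : ℝ) + 1)) (m + 1) x
      = birkhoffSum T f (m + 1) x - (m + 1 : ℕ) * ((∫ x, f x ∂μ) + 1 / ((k : ℝ) + 1)) := by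
    simp only [birkhoffSum, Finset.sum_sub_distrib, Finset.sum_const, Finset.card_range,
      nsmul_eq_mul]
    ring
  rw [h2] at h1
  have hmpos : (0 : ℝ) < ((m + 1 : ℕ) : ℝ) := by positivity
  rw [div_le_iff₀ hmpos]
  have hB2 : B ≤ (m + 1 : ℕ) * (ε / 2) := by
    rw [div_le_iff₀ (half_pos hε)] at hN
    refine hN.trans ?_
    have : (N : ℝ) ≤ ((m + 1 : ℕ) : ℝ) := by exact_mod_cast (by omega : N ≤ m + 1)
    gcongr
  have h3 : ((m + 1 : ℕ) : ℝ) * (1 / ((k : ℝ) + 1)) ≤ ((m + 1 : ℕ) : ℝ) * (ε / 2) := by gcongr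
  nlinarith

theorem birkhoff_bounded {α : Type*} [MeasurableSpace α] {μ : Measure α} [IsProbabilityMeasure μ]
    {T : α → α} {f : α → ℝ} (hT : Ergodic T μ) (hf : Measurable f) {C : ℝ}
    (hC : ∀ x, |f x| ≤ C) :
    ∀ᵐ x ∂μ, Tendsto (fun n : ℕ => birkhoffSum T f n x / n) atTop (𝓝 (∫ x, f x ∂μ)) := by
  have hC' : ∀ x, |(-f) x| ≤ C := fun x => by simpa using hC x
  filter_upwards [birkhoff_upper hT hf hC, birkhoff_upper hT hf.neg hC'] with x h1 h2
  rw [Metric.tendsto_nhds]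
  intro ε hε
  filter_upwards [h1 (ε / 2) (half_pos hε), h2 (ε / 2) (half_pos hε)] with n h3 h4
  rw [birkhoffSum_neg, neg_div] at h4
  simp only [Pi.neg_apply] at h4
  rw [integral_neg] at h4
  rw [Real.dist_eq, abs_lt]
  constructor <;> linarith

/-! ### Changes of variables -/

lemma branch_image (a : ℕ) :
    (fun t : ℝ => ((a : ℝ) + 1 + t)⁻¹) '' Set.Ico 0 1 = {x : ℝ | 0 < x ∧ ⌊x⁻¹⌋₊ = a + 1} := by
  ext x
  simp only [Set.mem_image, Set.mem_Ico, Set.mem_ofPred_eq]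
  constructor
  · rintro ⟨t, ⟨h0, h1⟩, rfl⟩
    refine ⟨by positivity, ?_⟩
    rw [inv_inv, Nat.floor_eq_iff (by positivity)]
    push_cast
    constructor <;> linarith
  · rintro ⟨h0, h1⟩
    rw [Nat.floor_eq_iff (by positivity)] at h1
    push_cast at h1
    refine ⟨x⁻¹ - (a + 1), ⟨by linarith, by linarith⟩, ?_⟩
    rw [add_sub_cancel, inv_inv]

lemma lintegral_branches (F : ℝ → ENNReal) :
    ∫⁻ x in Set.Ioo (0 : ℝ) 1, F x = ∑' a : ℕ, ∫⁻ t in Set.Ioo (0 : ℝ) 1,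
      ENNReal.ofReal ((((a : ℝ) + 1 + t) ^ 2)⁻¹) * F (((a : ℝ) + 1 + t)⁻¹) := by
  have hU : (⋃ a : ℕ, (fun t : ℝ => ((a : ℝ) + 1 + t)⁻¹) '' Set.Ico 0 1) = Set.Ioc (0 : ℝ) 1 := by
    simp_rw [branch_image]
    ext x
    simp only [Set.mem_iUnion, Set.mem_ofPred_eq, Set.mem_Ioc]
    constructor
    · rintro ⟨a, h0, h1⟩
      refine ⟨h0, ?_⟩
      rw [Nat.floor_eq_iff (by positivity)] at h1
      push_cast at h1
      have : 1 ≤ x⁻¹ := by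
        have : (0 : ℝ) ≤ a := Nat.cast_nonneg a
        linarith
      exact (one_le_inv₀ h0).1 this
    · rintro ⟨h0, h1⟩
      have : 1 ≤ ⌊x⁻¹⌋₊ := by
        rw [Nat.one_le_floor_iff]
        exact (one_le_inv₀ h0).2 h1
      exact ⟨⌊x⁻¹⌋₊ - 1, h0, by omega⟩
  have hL : ∫⁻ x in Set.Ioo (0 : ℝ) 1, F x
      = ∫⁻ x in ⋃ a : ℕ, (fun t : ℝ => ((a : ℝ) + 1 + t)⁻¹) '' Set.Ico 0 1, F x := by
    rw [hU, restrict_Ioo_eq_restrict_Ioc]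
  rw [hL, lintegral_iUnion]
  · congr 1
    ext a
    rw [restrict_Ioo_eq_restrict_Ico, lintegral_image_eq_lintegral_abs_deriv_mul
      (f' := fun t => -(((a : ℝ) + 1 + t) ^ 2)⁻¹) measurableSet_Ico]
    · refine setLIntegral_congr_fun measurableSet_Ico fun t ht => ?_
      simp only [abs_neg]
      rw [abs_of_nonneg (by positivity)]
    · intro t ht
      have h : ((a : ℝ) + 1 + t) ≠ 0 := by
        have := ht.1
        positivity
      have := ((hasDerivAt_id t).const_add ((a : ℝ) + 1)).inv h
      refine (this.congr_deriv ?_).hasDerivWithinAt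
      simp [neg_div]
    · intro s hs t ht hst
      have := inv_injective hst
      linarith
  · intro a
    rw [branch_image]
    exact (measurableSet_lt measurable_const measurable_id).inter
      (measurableSet_eq_fun (Nat.measurable_floor.comp measurable_inv) measurable_const)
  · intro a b hab
    simp only [Function.onFun]
    rw [branch_image, branch_image, Set.disjoint_left]
    rintro x ⟨_, h1⟩ ⟨_, h2⟩
    omega

lemma lintegral_theta {y : ℝ} (hy : 0 < y) (φ : ℝ → ENNReal) :
    ∫⁻ x in Set.Ioo (0 : ℝ) 1, ENNReal.ofReal (((1 + x * y) ^ 2)⁻¹) * φ (x / (1 + x * y))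
      = ∫⁻ t in Set.Ioo (0 : ℝ) (1 + y)⁻¹, φ t := by
  have himg : (fun x : ℝ => x / (1 + x * y)) '' Set.Ioo 0 1 = Set.Ioo (0 : ℝ) (1 + y)⁻¹ := by
    ext t
    simp only [Set.mem_image, Set.mem_Ioo]
    constructor
    · rintro ⟨x, ⟨h0, h1⟩, rfl⟩
      refine ⟨by positivity, ?_⟩
      rw [← one_div, div_lt_div_iff₀ (by positivity) (by positivity)]
      nlinarith
    · rintro ⟨h0, h1⟩
      rw [lt_inv_comm₀ h0 (by positivity)] at h1
      have h2 : t * t⁻¹ = 1 := mul_inv_cancel₀ h0.ne'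
      have h3 : 0 < 1 - t * y := by nlinarith
      refine ⟨t / (1 - t * y), ⟨by positivity, ?_⟩, ?_⟩
      · rw [div_lt_one h3]
        nlinarith
      · field_simp
        ring
  rw [← himg, lintegral_image_eq_lintegral_abs_deriv_mul
      (f' := fun x => ((1 + x * y) ^ 2)⁻¹) measurableSet_Ioo]
  · refine setLIntegral_congr_fun measurableSet_Ioo fun t ht => ?_
    rw [abs_of_nonneg (by positivity)]
  · intro x hx
    have h : 1 + x * y ≠ 0 := by
      have := hx.1
      positivity
    have := (hasDerivAt_id x).div (((hasDerivAt_id x).mul_const y).const_add 1) h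
    refine (this.congr_deriv ?_).hasDerivWithinAt
    simp only [id]
    field_simp
    ring
  · intro s hs t ht hst
    have h1 : 0 < 1 + s * y := by have := hs.1; positivity
    have h2 : 0 < 1 + t * y := by have := ht.1; positivity
    simp only at hst
    rw [div_eq_div_iff h1.ne' h2.ne'] at hst
    linarith

lemma gaussMap_branch (a : ℕ) {t : ℝ} (h0 : 0 ≤ t) (h1 : t < 1) :
    gaussMap (((a : ℝ) + 1 + t)⁻¹) = t := by
  rw [gaussMap, inv_inv, add_assoc, Int.fract_natCast_add, Int.fract_one_add]
  exact Int.fract_eq_self.2 ⟨h0, h1⟩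

lemma floor_branch (a : ℕ) {t : ℝ} (h0 : 0 ≤ t) (h1 : t < 1) :
    ⌊(((a : ℝ) + 1 + t)⁻¹)⁻¹⌋ = (a : ℤ) + 1 := by
  rw [inv_inv, Int.floor_eq_iff]
  push_cast
  constructor <;> linarith

lemma gaussMap_measurable : Measurable gaussMap := measurable_fract.comp measurable_inv

/-! ### The natural extension -/

/-- The natural extension of the Gauss map. -/
noncomputable def natExt (p : ℝ × ℝ) : ℝ × ℝ :=
  (gaussMap p.1, ((⌊p.1⁻¹⌋ : ℝ) + p.2)⁻¹)

/-- The Gauss measure. -/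
noncomputable def gaussMeasure : Measure ℝ :=
  (volume.restrict (Set.Ioo (0 : ℝ) 1)).withDensity
    (fun x => ENNReal.ofReal ((Real.log 2)⁻¹ * (1 + x)⁻¹))

/-- The invariant measure of the natural extension. -/
noncomputable def natMeasure : Measure (ℝ × ℝ) :=
  ((volume.restrict (Set.Ioo (0 : ℝ) 1)).prod (volume.restrict (Set.Ioo (0 : ℝ) 1))).withDensity
    (fun p => ENNReal.ofReal ((Real.log 2)⁻¹ * ((1 + p.1 * p.2) ^ 2)⁻¹))

lemma log_two_inv_pos : 0 < (Real.log 2)⁻¹ := inv_pos.2 (Real.log_pos one_lt_two)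

lemma natExt_measurable : Measurable natExt := by
  refine (gaussMap_measurable.comp measurable_fst).prodMk (Measurable.inv (Measurable.add ?_ measurable_snd))
  have h1 : Measurable (fun p : ℝ × ℝ => ⌊p.1⁻¹⌋) := Int.measurable_floor.comp measurable_fst.inv
  exact (measurable_of_countable (fun n : ℤ => (n : ℝ))).comp h1

lemma dens_measurable : Measurable
    (fun p : ℝ × ℝ => ENNReal.ofReal ((Real.log 2)⁻¹ * ((1 + p.1 * p.2) ^ 2)⁻¹)) := by
  fun_prop

lemma lintegral_natMeasure {h : ℝ × ℝ → ENNReal} (hh : Measurable h) :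
    ∫⁻ p, h p ∂natMeasure = ∫⁻ x in Set.Ioo (0 : ℝ) 1, ∫⁻ y in Set.Ioo (0 : ℝ) 1,
      ENNReal.ofReal ((Real.log 2)⁻¹ * ((1 + x * y) ^ 2)⁻¹) * h (x, y) := by
  rw [natMeasure, lintegral_withDensity_eq_lintegral_mul _ dens_measurable hh, lintegral_prod]
  · rfl
  · exact (dens_measurable.mul hh).aemeasurable

lemma lintegral_natMeasure_symm {h : ℝ × ℝ → ENNReal} (hh : Measurable h) :
    ∫⁻ p, h p ∂natMeasure = ∫⁻ y in Set.Ioo (0 : ℝ) 1, ∫⁻ x in Set.Ioo (0 : ℝ) 1,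
      ENNReal.ofReal ((Real.log 2)⁻¹ * ((1 + x * y) ^ 2)⁻¹) * h (x, y) := by
  rw [natMeasure, lintegral_withDensity_eq_lintegral_mul _ dens_measurable hh, lintegral_prod_symm]
  · rfl
  · exact (dens_measurable.mul hh).aemeasurable

lemma dens_branch {u v : ℝ} (hu : 0 < u) (hv : 0 ≤ v) :
    ENNReal.ofReal ((u ^ 2)⁻¹) * ENNReal.ofReal ((Real.log 2)⁻¹ * ((1 + u⁻¹ * v) ^ 2)⁻¹)
      = ENNReal.ofReal ((Real.log 2)⁻¹ * ((u + v) ^ 2)⁻¹) := by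
  rw [← ENNReal.ofReal_mul (by positivity)]
  congr 1
  have h := log_two_inv_pos
  have : 0 < u + v := by positivity
  have h2 : 1 + u⁻¹ * v = (u + v) / u := by field_simp
  rw [h2]
  field_simp

lemma lintegral_natExt {h : ℝ × ℝ → ENNReal} (hh : Measurable h) :
    ∫⁻ p, h (natExt p) ∂natMeasure = ∫⁻ p, h p ∂natMeasure := by
  have h0 : Measurable fun p => h (natExt p) := hh.comp natExt_measurable
  rw [lintegral_natMeasure_symm h0, lintegral_natMeasure hh]
  have e1 : ∀ y ∈ Set.Ioo (0 : ℝ) 1, ∫⁻ x in Set.Ioo (0 : ℝ) 1,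
      ENNReal.ofReal ((Real.log 2)⁻¹ * ((1 + x * y) ^ 2)⁻¹) * h (natExt (x, y))
      = ∑' a : ℕ, ∫⁻ t in Set.Ioo (0 : ℝ) 1,
        ENNReal.ofReal ((Real.log 2)⁻¹ * (((a : ℝ) + 1 + t + y) ^ 2)⁻¹)
          * h (t, ((a : ℝ) + 1 + y)⁻¹) := by
    intro y hy
    rw [lintegral_branches]
    congr 1
    ext a
    refine setLIntegral_congr_fun measurableSet_Ioo fun t ht => ?_
    have ht0 := ht.1
    simp only [natExt]
    rw [← mul_assoc, dens_branch (by positivity) hy.1.le, gaussMap_branch a ht.1.le ht.2,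
      floor_branch a ht.1.le ht.2]
    push_cast
    rfl
  have e2 : ∀ t ∈ Set.Ioo (0 : ℝ) 1, ∫⁻ s in Set.Ioo (0 : ℝ) 1,
      ENNReal.ofReal ((Real.log 2)⁻¹ * ((1 + t * s) ^ 2)⁻¹) * h (t, s)
      = ∑' a : ℕ, ∫⁻ y in Set.Ioo (0 : ℝ) 1,
        ENNReal.ofReal ((Real.log 2)⁻¹ * (((a : ℝ) + 1 + t + y) ^ 2)⁻¹)
          * h (t, ((a : ℝ) + 1 + y)⁻¹) := by
    intro t ht
    rw [lintegral_branches]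
    congr 1
    ext a
    refine setLIntegral_congr_fun measurableSet_Ioo fun y hy => ?_
    have hy0 := hy.1
    rw [← mul_assoc, mul_comm t, dens_branch (by positivity) ht.1.le, add_right_comm]
  have hm : ∀ a : ℕ, Measurable (fun p : ℝ × ℝ =>
      ENNReal.ofReal ((Real.log 2)⁻¹ * (((a : ℝ) + 1 + p.1 + p.2) ^ 2)⁻¹)
          * h (p.1, ((a : ℝ) + 1 + p.2)⁻¹)) := by
    intro a
    refine Measurable.mul (by fun_prop) (hh.comp (by fun_prop))
  have g1 := setLIntegral_congr_fun (μ := volume) measurableSet_Ioo e1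
  have g2 := setLIntegral_congr_fun (μ := volume) measurableSet_Ioo e2
  rw [g1, g2, lintegral_tsum, lintegral_tsum]
  · congr 1
    ext a
    rw [lintegral_lintegral_swap]
    exact ((hm a).comp measurable_swap).aemeasurable
  · intro a
    exact (hm a).lintegral_prod_right'.aemeasurable
  · intro a
    exact (hm a).lintegral_prod_left'.aemeasurable

lemma natExt_measurePreserving : MeasurePreserving natExt natMeasure natMeasure := by
  refine ⟨natExt_measurable, ?_⟩
  ext A hA
  rw [Measure.map_apply natExt_measurable hA, ← lintegral_indicator_one hA,
    ← lintegral_indicator_one (natExt_measurable hA)]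
  exact lintegral_natExt (measurable_one.indicator hA)

lemma fst_measurePreserving : MeasurePreserving Prod.fst natMeasure gaussMeasure := by
  refine ⟨measurable_fst, ?_⟩
  ext A hA
  rw [Measure.map_apply measurable_fst hA, ← lintegral_indicator_one (measurable_fst hA),
    lintegral_natMeasure (measurable_one.indicator (measurable_fst hA)),
    ← lintegral_indicator_one hA, gaussMeasure, lintegral_withDensity_eq_lintegral_mul _
      (by fun_prop) (measurable_one.indicator hA)]
  refine setLIntegral_congr_fun measurableSet_Ioo fun x hx => ?_
  have hx0 := hx.1
  have h := lintegral_theta hx.1 (fun _ => 1)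
  simp only [mul_one, lintegral_const, Measure.restrict_apply, MeasurableSet.univ,
    Set.univ_inter, Real.volume_Ioo, sub_zero, one_mul] at h
  simp only [Pi.mul_apply]
  have h3 : ∀ y : ℝ, (Prod.fst ⁻¹' A).indicator (1 : ℝ × ℝ → ENNReal) (x, y)
      = A.indicator 1 x := fun y => rfl
  simp_rw [h3]
  have hl := log_two_inv_pos
  rw [lintegral_mul_const _ (by fun_prop)]
  congr 1
  rw [ENNReal.ofReal_mul hl.le, ← h, ← lintegral_const_mul _ (by fun_prop)]
  refine lintegral_congr fun y => ?_
  rw [ENNReal.ofReal_mul hl.le, mul_comm y]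

lemma integral_inv_one_add (a : ℝ) (ha : -1 < a) (ha1 : a ≤ 1):
    ∫ y in a..1, (1 + y)⁻¹ = Real.log (2 / (1 + a)) := by
  rw [intervalIntegral.integral_comp_add_left (fun y : ℝ => y⁻¹) 1, integral_inv]
  · norm_num
  · rw [Set.uIcc_of_le (by linarith)]
    intro h
    linarith [h.1]

instance gaussMeasure_prob : IsProbabilityMeasure gaussMeasure := by
  constructor
  have hl := log_two_inv_pos
  rw [gaussMeasure, withDensity_apply _ MeasurableSet.univ, Measure.restrict_univ,
    ← ofReal_integral_eq_lintegral_ofReal]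
  · rw [← integral_Ioc_eq_integral_Ioo, ← intervalIntegral.integral_of_le zero_le_one,
      intervalIntegral.integral_const_mul, integral_inv_one_add 0 (by norm_num) (by norm_num)]
    norm_num
  · have : ContinuousOn (fun x : ℝ => (Real.log 2)⁻¹ * (1 + x)⁻¹) (Set.Icc 0 1) := by
      refine continuousOn_const.mul (ContinuousOn.inv₀ (by fun_prop) ?_)
      intro x hx
      have := hx.1
      positivity
    exact (this.integrableOn_Icc).mono_set Set.Ioo_subset_Icc_self
  · filter_upwards [ae_restrict_mem measurableSet_Ioo] with x hx
    have := hx.1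
    simp only [Pi.zero_apply]
    positivity

lemma ae_of_ae_gauss {p : ℝ → Prop} (h : ∀ᵐ x ∂gaussMeasure, p x) :
    ∀ᵐ x ∂(volume.restrict (Set.Ioo (0 : ℝ) 1)), p x := by
  refine (withDensity_absolutelyContinuous' (by fun_prop) ?_).ae_le h
  filter_upwards [ae_restrict_mem measurableSet_Ioo] with x hx
  have := hx.1
  have hl := log_two_inv_pos
  rw [ENNReal.ofReal_ne_zero_iff]
  positivity

lemma ae_gauss_good : ∀ᵐ x ∂gaussMeasure, Irrational x ∧ 0 < x ∧ x < 1 := by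
  refine (withDensity_absolutelyContinuous _ _).ae_le ?_
  have h : ∀ᵐ x : ℝ, Irrational x := by
    have := (Set.countable_range ((↑) : ℚ → ℝ)).ae_notMem volume
    exact this
  filter_upwards [ae_restrict_mem measurableSet_Ioo, ae_restrict_of_ae h] with x hx hi
  exact ⟨hi, hx.1, hx.2⟩

/-! ### The transfer operator of the Gauss map -/

/-- Weights of the normalized transfer operator. -/
noncomputable def gw (a : ℕ) (x : ℝ) : ℝ := (1 + x) / (((a : ℝ) + 1 + x) * ((a : ℝ) + 2 + x))

/-- The normalized transfer operator. -/
noncomputable def gP (f : ℝ → ℝ) (x : ℝ) : ℝ := ∑' a : ℕ, gw a x * f (((a : ℝ) + 1 + x)⁻¹)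

lemma gw_nonneg (a : ℕ) {x : ℝ} (hx : 0 ≤ x) : 0 ≤ gw a x := by
  unfold gw; positivity

lemma gw_hasSum {x : ℝ} (hx : 0 ≤ x) : HasSum (fun a => gw a x) 1 := by
  rw [hasSum_iff_tendsto_nat_of_nonneg (fun a => gw_nonneg a hx)]
  have h : ∀ n : ℕ, ∑ i ∈ Finset.range n, gw i x = 1 - (1 + x) / ((n : ℝ) + (1 + x)) := by
    intro n
    induction n with
    | zero =>
      have : 1 + x ≠ 0 := by positivity
      simp [this]
    | succ n ih =>
      rw [Finset.sum_range_succ, ih, gw]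
      push_cast
      have h1 : (n : ℝ) + 1 + x ≠ 0 := by positivity
      have h2 : (n : ℝ) + 2 + x ≠ 0 := by positivity
      have h3 : (n : ℝ) + (1 + x) ≠ 0 := by positivity
      have h4 : (n : ℝ) + 1 + (1 + x) ≠ 0 := by positivity
      field_simp
      ring
  simp_rw [h]
  have : Tendsto (fun n : ℕ => (1 + x) / ((n : ℝ) + (1 + x))) atTop (𝓝 0) :=
    tendsto_const_nhds.div_atTop
      (tendsto_atTop_add_const_right _ _ tendsto_natCast_atTop_atTop)
  simpa using this.const_sub 1

/-- `f` takes values in `[0,1]` on `[0,1]`. -/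
def Unitary01 (f : ℝ → ℝ) : Prop := ∀ x ∈ Set.Icc (0 : ℝ) 1, 0 ≤ f x ∧ f x ≤ 1

lemma branch_mem (a : ℕ) {x : ℝ} (hx : 0 ≤ x) : ((a : ℝ) + 1 + x)⁻¹ ∈ Set.Icc (0 : ℝ) 1 := by
  refine ⟨by positivity, inv_le_one_of_one_le₀ ?_⟩
  have : (0 : ℝ) ≤ a := Nat.cast_nonneg a
  linarith

lemma gP_summable_aux {x : ℝ} (hx : 0 ≤ x) {g : ℕ → ℝ} {C : ℝ} (hg : ∀ a, |g a| ≤ C) :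
    Summable fun a => gw a x * g a := by
  refine Summable.of_norm_bounded ((gw_hasSum hx).summable.mul_right C) fun a => ?_
  rw [norm_mul, Real.norm_of_nonneg (gw_nonneg a hx)]
  exact mul_le_mul_of_nonneg_left (hg a) (gw_nonneg a hx)

lemma Unitary01.summable {f : ℝ → ℝ} (hf : Unitary01 f) {x : ℝ} (hx : 0 ≤ x) :
    Summable fun a : ℕ => gw a x * f (((a : ℝ) + 1 + x)⁻¹) := by
  refine gP_summable_aux hx (C := 1) fun a => ?_
  have := hf _ (branch_mem a hx)
  rw [abs_of_nonneg this.1]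
  exact this.2

lemma Unitary01.gP {f : ℝ → ℝ} (hf : Unitary01 f) : Unitary01 (gP f) := by
  intro x hx
  constructor
  · exact tsum_nonneg fun a => mul_nonneg (gw_nonneg a hx.1) (hf _ (branch_mem a hx.1)).1
  · rw [← (gw_hasSum hx.1).tsum_eq]
    refine (hf.summable hx.1).tsum_le_tsum (fun a => ?_) (gw_hasSum hx.1).summable
    exact mul_le_of_le_one_right (gw_nonneg a hx.1) (hf _ (branch_mem a hx.1)).2

lemma gP_one_sub {f : ℝ → ℝ} (hf : Unitary01 f) {x : ℝ} (hx : 0 ≤ x) :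
    gP (fun t => 1 - f t) x = 1 - gP f x := by
  unfold _root_.gP
  simp_rw [mul_sub, mul_one]
  rw [(gw_hasSum hx).summable.tsum_sub (hf.summable hx), (gw_hasSum hx).tsum_eq]

lemma gP_measurable {f : ℝ → ℝ} (hf : Measurable f) : Measurable (gP f) := by
  refine Measurable.tsum fun a => ?_
  unfold gw
  exact Measurable.mul (by fun_prop) (hf.comp (by fun_prop))

lemma gw_sub (a : ℕ) {x y : ℝ} (hx : 0 ≤ x) (hy : 0 ≤ y) :
    gw a x - gw a y = (y - x) * ((1 + x) * (1 + y) - ((a : ℝ) + 1) * a) /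
      (((a : ℝ) + 1 + x) * ((a : ℝ) + 2 + x) * (((a : ℝ) + 1 + y) * ((a : ℝ) + 2 + y))) := by
  unfold gw
  have h1 : (a : ℝ) + 1 + x ≠ 0 := by positivity
  have h2 : (a : ℝ) + 2 + x ≠ 0 := by positivity
  have h3 : (a : ℝ) + 1 + y ≠ 0 := by positivity
  have h4 : (a : ℝ) + 2 + y ≠ 0 := by positivity
  field_simp
  ring

lemma gP_antitone {f : ℝ → ℝ} (hf : Unitary01 f) (hm : MonotoneOn f (Set.Icc 0 1)) :
    AntitoneOn (gP f) (Set.Icc 0 1) := by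
  intro x hx y hy hxy
  have hx0 := hx.1
  have hy0 := hy.1
  have hb : ∀ a : ℕ, |f (((a : ℝ) + 1 + y)⁻¹)| ≤ 1 := fun a => by
    have := hf _ (branch_mem a hy0)
    rw [abs_of_nonneg this.1]
    exact this.2
  have hsx := gP_summable_aux hx0 hb
  have h1 : ∑' a : ℕ, gw a x * f (((a : ℝ) + 1 + y)⁻¹) ≤ gP f x := by
    refine hsx.tsum_le_tsum (fun a => ?_) (hf.summable hx0)
    refine mul_le_mul_of_nonneg_left (hm (branch_mem a hy0) (branch_mem a hx0) ?_)
      (gw_nonneg a hx0)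
    gcongr
  refine le_trans ?_ h1
  have hsy := hf.summable hy0
  rw [← sub_nonneg]
  unfold gP
  rw [← hsx.tsum_sub hsy]
  set c := f ((((1 : ℕ) : ℝ) + 1 + y)⁻¹) with hc
  have hz : ∑' a : ℕ, (gw a x - gw a y) * c = 0 := by
    rw [tsum_mul_right, (gw_hasSum hx0).summable.tsum_sub (gw_hasSum hy0).summable,
      (gw_hasSum hx0).tsum_eq, (gw_hasSum hy0).tsum_eq]
    simp
  have hsz : Summable fun a : ℕ => (gw a x - gw a y) * c :=
    ((gw_hasSum hx0).summable.sub (gw_hasSum hy0).summable).mul_right c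
  have hk := (hsx.sub hsy).tsum_sub hsz
  rw [hz, sub_zero] at hk
  rw [← hk]
  refine tsum_nonneg fun a => ?_
  have e : gw a x * f (((a : ℝ) + 1 + y)⁻¹) - gw a y * f (((a : ℝ) + 1 + y)⁻¹)
      - (gw a x - gw a y) * c = (gw a x - gw a y) * (f (((a : ℝ) + 1 + y)⁻¹) - c) := by ring
  rw [e, gw_sub a hx0 hy0]
  rcases Nat.lt_trichotomy a 1 with h | h | h
  · obtain rfl : a = 0 := by omega
    refine mul_nonneg (div_nonneg (mul_nonneg (by linarith) ?_) (by positivity)) ?_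
    · simp; positivity
    · rw [sub_nonneg]
      refine hm (branch_mem 1 hy0) (branch_mem 0 hy0) ?_
      gcongr
  · subst h
    simp [hc]
  · have ha : (2 : ℝ) ≤ a := by exact_mod_cast h
    refine mul_nonneg_of_nonpos_of_nonpos (div_nonpos_of_nonpos_of_nonneg
      (mul_nonpos_of_nonneg_of_nonpos (by linarith) ?_) (by positivity)) ?_
    · have h4 : (1 + x) * (1 + y) ≤ 2 * 2 := by
        have := hx.2
        have := hy.2
        gcongr <;> linarith
      nlinarith
    · rw [sub_nonpos]
      refine hm (branch_mem a hy0) (branch_mem 1 hy0) ?_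
      gcongr

lemma gP_osc {f : ℝ → ℝ} (hf : Unitary01 f) (hm : MonotoneOn f (Set.Icc 0 1)) :
    gP f 0 - gP f 1 ≤ (f 1 - f 0) / 2 := by
  have h0 : gP f 0 = f 1 / 2 + gP f 1 / 2 := by
    have h := (hf.summable le_rfl).tsum_eq_zero_add
    rw [gP, h]
    congr 1
    · simp [gw]; ring
    · rw [gP, ← tsum_div_const]
      congr 1
      ext a
      have e : (((a + 1 : ℕ) : ℝ) + 1 + 0) = (a : ℝ) + 1 + 1 := by push_cast; ring
      rw [e]
      unfold gw
      push_cast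
      have h1 : (a : ℝ) + 1 + 1 ≠ 0 := by positivity
      have h2 : (a : ℝ) + 2 + 1 ≠ 0 := by positivity
      have h3 : (a : ℝ) + 1 + 1 + 0 ≠ 0 := by positivity
      have h4 : (a : ℝ) + 1 + 2 + 0 ≠ 0 := by positivity
      field_simp
      ring
  have h1 : f 0 ≤ gP f 1 := by
    have h := (gw_hasSum zero_le_one).mul_right (f 0)
    rw [one_mul] at h
    rw [← h.tsum_eq]
    refine h.summable.tsum_le_tsum (fun a => ?_) (hf.summable zero_le_one)
    refine mul_le_mul_of_nonneg_left ?_ (gw_nonneg a zero_le_one)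
    exact hm ⟨le_rfl, zero_le_one⟩ (branch_mem a zero_le_one) (branch_mem a zero_le_one).1
  linarith

lemma lintegral_gauss (h : ℝ → ENNReal) (hh : Measurable h) :
    ∫⁻ x, h x ∂gaussMeasure
      = ∫⁻ x in Set.Ioo (0 : ℝ) 1, ENNReal.ofReal ((Real.log 2)⁻¹ * (1 + x)⁻¹) * h x := by
  rw [gaussMeasure, lintegral_withDensity_eq_lintegral_mul _ (by fun_prop) hh]
  rfl

lemma gauss_duality {f : ℝ → ℝ} (hfm : Measurable f) (hf : Unitary01 f) {A : Set ℝ}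
    (hA : MeasurableSet A) :
    ∫⁻ x in gaussMap ⁻¹' A, ENNReal.ofReal (f x) ∂gaussMeasure
      = ∫⁻ x in A, ENNReal.ofReal (gP f x) ∂gaussMeasure := by
  have hl := log_two_inv_pos
  rw [← lintegral_indicator (gaussMap_measurable hA), ← lintegral_indicator hA,
    lintegral_gauss _ (hfm.ennreal_ofReal.indicator (gaussMap_measurable hA)),
    lintegral_gauss _ ((gP_measurable hfm).ennreal_ofReal.indicator hA), lintegral_branches,
    ← lintegral_tsum]
  · refine setLIntegral_congr_fun measurableSet_Ioo fun t ht => ?_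
    have ht0 := ht.1
    have ht1 := ht.2
    have hind : ∀ a : ℕ, (gaussMap ⁻¹' A).indicator (fun x => ENNReal.ofReal (f x))
        (((a : ℝ) + 1 + t)⁻¹) = A.indicator (fun _ => ENNReal.ofReal (f (((a : ℝ) + 1 + t)⁻¹))) t := by
      intro a
      have hmem : ((a : ℝ) + 1 + t)⁻¹ ∈ gaussMap ⁻¹' A ↔ t ∈ A := by
        rw [Set.mem_preimage, gaussMap_branch a ht0.le ht1]
      by_cases htA : t ∈ A
      · rw [Set.indicator_of_mem htA, Set.indicator_of_mem (hmem.2 htA)]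
      · rw [Set.indicator_of_notMem htA, Set.indicator_of_notMem (fun h => htA (hmem.1 h))]
    simp_rw [hind]
    by_cases htA : t ∈ A
    · simp only [Set.indicator_of_mem htA]
      unfold gP
      rw [ENNReal.ofReal_tsum_of_nonneg
        (fun a => mul_nonneg (gw_nonneg a ht0.le) (hf _ (branch_mem a ht0.le)).1)
        (hf.summable ht0.le), ← ENNReal.tsum_mul_left]
      congr 1
      ext a
      rw [← ENNReal.ofReal_mul (by positivity), ← ENNReal.ofReal_mul (by positivity),
        ← ENNReal.ofReal_mul (by positivity)]
      congr 1
      unfold gw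
      have h2 : 1 + ((a : ℝ) + 1 + t)⁻¹ = ((a : ℝ) + 2 + t) / ((a : ℝ) + 1 + t) := by
        field_simp
        ring
      rw [h2]
      field_simp
    · simp [Set.indicator_of_notMem htA]
  · intro a
    refine Measurable.aemeasurable ?_
    refine Measurable.mul (by fun_prop) (Measurable.mul (by fun_prop) ?_)
    exact (hfm.ennreal_ofReal.indicator (gaussMap_measurable hA)).comp (by fun_prop)

lemma ae_gauss_Icc : ∀ᵐ x ∂gaussMeasure, x ∈ Set.Icc (0 : ℝ) 1 :=
  ae_gauss_good.mono fun _ h => ⟨h.2.1.le, h.2.2.le⟩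

lemma Unitary01.integrable {f : ℝ → ℝ} (hfm : Measurable f) (hf : Unitary01 f) :
    Integrable f gaussMeasure := by
  refine Integrable.of_bound hfm.aestronglyMeasurable 1 ?_
  filter_upwards [ae_gauss_Icc] with x hx
  rw [Real.norm_of_nonneg (hf x hx).1]
  exact (hf x hx).2

lemma gauss_duality_integral {f : ℝ → ℝ} (hfm : Measurable f) (hf : Unitary01 f) {A : Set ℝ}
    (hA : MeasurableSet A) :
    ∫ x in gaussMap ⁻¹' A, f x ∂gaussMeasure = ∫ x in A, gP f x ∂gaussMeasure := by
  rw [integral_eq_lintegral_of_nonneg_ae, integral_eq_lintegral_of_nonneg_ae,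
    gauss_duality hfm hf hA]
  · exact ae_restrict_of_ae (ae_gauss_Icc.mono fun x hx => (hf.gP x hx).1)
  · exact (gP_measurable hfm).aestronglyMeasurable
  · exact ae_restrict_of_ae (ae_gauss_Icc.mono fun x hx => (hf x hx).1)
  · exact hfm.aestronglyMeasurable

/-- Monotone or antitone functions with oscillation at most `δ`. -/
structure GoodClass (f : ℝ → ℝ) (δ : ℝ) : Prop where
  meas : Measurable f
  unit : Unitary01 f
  mono : (MonotoneOn f (Set.Icc 0 1) ∧ f 1 - f 0 ≤ δ) ∨ (AntitoneOn f (Set.Icc 0 1) ∧ f 0 - f 1 ≤ δ)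

lemma GoodClass.gP {f : ℝ → ℝ} {δ : ℝ} (h : GoodClass f δ) : GoodClass (gP f) (δ / 2) := by
  refine ⟨gP_measurable h.meas, h.unit.gP, ?_⟩
  rcases h.mono with ⟨h1, h2⟩ | ⟨h1, h2⟩
  · right
    refine ⟨gP_antitone h.unit h1, (gP_osc h.unit h1).trans (by linarith)⟩
  · left
    have hu : Unitary01 (fun t => 1 - f t) := fun x hx => by
      have := h.unit x hx
      constructor <;> linarith
    have hm : MonotoneOn (fun t => 1 - f t) (Set.Icc 0 1) := fun x hx y hy hxy => by
      have := h1 hx hy hxy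
      simp only
      linarith
    have ha := gP_antitone hu hm
    have ho := gP_osc hu hm
    rw [gP_one_sub h.unit le_rfl, gP_one_sub h.unit zero_le_one] at ho
    constructor
    · intro x hx y hy hxy
      have := ha hx hy hxy
      rw [gP_one_sub h.unit hx.1, gP_one_sub h.unit hy.1] at this
      linarith
    · linarith

lemma GoodClass.near {f : ℝ → ℝ} {δ : ℝ} (h : GoodClass f δ) :
    ∃ c, ∀ x ∈ Set.Icc (0 : ℝ) 1, c ≤ f x ∧ f x ≤ c + δ := by
  have m0 : (0 : ℝ) ∈ Set.Icc (0 : ℝ) 1 := ⟨le_rfl, zero_le_one⟩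
  have m1 : (1 : ℝ) ∈ Set.Icc (0 : ℝ) 1 := ⟨zero_le_one, le_rfl⟩
  rcases h.mono with ⟨h1, h2⟩ | ⟨h1, h2⟩
  · refine ⟨f 0, fun x hx => ⟨h1 m0 hx hx.1, ?_⟩⟩
    have := h1 hx m1 hx.2
    linarith
  · refine ⟨f 1, fun x hx => ⟨h1 hx m1 hx.2, ?_⟩⟩
    have := h1 m0 hx hx.1
    linarith

lemma setIntegral_near {f : ℝ → ℝ} (hi : Integrable f gaussMeasure) {c δ : ℝ}
    (hc : ∀ x ∈ Set.Icc (0 : ℝ) 1, c ≤ f x ∧ f x ≤ c + δ) (A : Set ℝ) :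
    gaussMeasure.real A * c ≤ ∫ x in A, f x ∂gaussMeasure ∧
    ∫ x in A, f x ∂gaussMeasure ≤ gaussMeasure.real A * (c + δ) := by
  constructor
  · have : ∫ x in A, c ∂gaussMeasure ≤ ∫ x in A, f x ∂gaussMeasure := by
      refine integral_mono_ae (integrable_const _) hi.integrableOn ?_
      exact ae_restrict_of_ae (ae_gauss_Icc.mono fun x hx => (hc x hx).1)
    simpa using this
  · have : ∫ x in A, f x ∂gaussMeasure ≤ ∫ x in A, (c + δ) ∂gaussMeasure := by
      refine integral_mono_ae hi.integrableOn (integrable_const _) ?_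
      exact ae_restrict_of_ae (ae_gauss_Icc.mono fun x hx => (hc x hx).2)
    simpa using this

lemma GoodClass.decorr {A : Set ℝ} (hA : MeasurableSet A) (hinv : gaussMap ⁻¹' A = A) (n : ℕ) :
    ∀ {f : ℝ → ℝ} {δ : ℝ}, GoodClass f δ →
    |∫ x in A, f x ∂gaussMeasure - gaussMeasure.real A * ∫ x, f x ∂gaussMeasure| ≤ δ / 2 ^ n := by
  induction n with
  | zero =>
    intro f δ h
    obtain ⟨c, hc⟩ := h.near
    have hi := h.unit.integrable h.meas
    have h1 := setIntegral_near hi hc A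
    have h2 := setIntegral_near hi hc Set.univ
    rw [setIntegral_univ, probReal_univ, one_mul, one_mul] at h2
    have h3 : 0 ≤ gaussMeasure.real A := measureReal_nonneg
    have h4 : gaussMeasure.real A ≤ 1 := measureReal_le_one
    rw [pow_zero, div_one, abs_le]
    have hδ : 0 ≤ δ := by
      have := hc 0 ⟨le_rfl, zero_le_one⟩
      linarith
    constructor <;> nlinarith
  | succ n ih =>
    intro f δ h
    have h1 := ih h.gP
    have e1 := gauss_duality_integral h.meas h.unit hA
    have e2 := gauss_duality_integral h.meas h.unit MeasurableSet.univ
    rw [hinv] at e1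
    rw [Set.preimage_univ, setIntegral_univ, setIntegral_univ] at e2
    rw [← e1, ← e2] at h1
    rw [pow_succ', ← div_div]
    exact h1

lemma gauss_invariant_indep {A : Set ℝ} (hA : MeasurableSet A) (hinv : gaussMap ⁻¹' A = A) (t : ℝ) :
    gaussMeasure.real (A ∩ Set.Iic t) = gaussMeasure.real A * gaussMeasure.real (Set.Iic t) := by
  have hg : GoodClass ((Set.Iic t).indicator 1) 1 := by
    refine ⟨measurable_one.indicator measurableSet_Iic, ?_, Or.inr ⟨?_, ?_⟩⟩
    · intro x _
      by_cases h : x ∈ Set.Iic t <;> simp [Set.indicator, h]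
    · intro x _ y _ hxy
      by_cases h : y ∈ Set.Iic t
      · have h' : x ∈ Set.Iic t := hxy.trans h
        simp [Set.indicator_of_mem h, Set.indicator_of_mem h']
      · rw [Set.indicator_of_notMem h]
        exact Set.indicator_nonneg (fun _ _ => zero_le_one) _
    · have h1 : (Set.Iic t).indicator (1 : ℝ → ℝ) 0 ≤ 1 := by
        by_cases h : (0 : ℝ) ∈ Set.Iic t <;> simp [Set.indicator, h]
      have h2 : 0 ≤ (Set.Iic t).indicator (1 : ℝ → ℝ) 1 :=
        Set.indicator_nonneg (fun _ _ => zero_le_one) _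
      linarith
  have h : |∫ x in A, (Set.Iic t).indicator 1 x ∂gaussMeasure
      - gaussMeasure.real A * ∫ x, (Set.Iic t).indicator 1 x ∂gaussMeasure| ≤ 0 := by
    have hlim : Tendsto (fun n : ℕ => (1 : ℝ) / 2 ^ n) atTop (𝓝 0) :=
      tendsto_const_nhds.div_atTop (tendsto_pow_atTop_atTop_of_one_lt one_lt_two)
    exact ge_of_tendsto' hlim (fun n => GoodClass.decorr hA hinv n hg)
  have h' := abs_nonpos_iff.1 h
  rw [integral_indicator_one measurableSet_Iic, integral_indicator_one measurableSet_Iic,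
    measureReal_restrict_apply measurableSet_Iic, Set.inter_comm] at h'
  linarith

theorem gauss_ergodic : Ergodic gaussMap gaussMeasure := by
  have hmp : MeasurePreserving gaussMap gaussMeasure gaussMeasure := by
    refine ⟨gaussMap_measurable, ?_⟩
    have h1 := natExt_measurePreserving.map_eq
    have h2 := fst_measurePreserving.map_eq
    have e : gaussMap ∘ Prod.fst = Prod.fst ∘ natExt := rfl
    calc Measure.map gaussMap gaussMeasure
        = Measure.map (gaussMap ∘ Prod.fst) natMeasure := by
          rw [← Measure.map_map gaussMap_measurable measurable_fst, h2]
      _ = gaussMeasure := by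
          rw [e, ← Measure.map_map measurable_fst natExt_measurable, h1, h2]
  refine ⟨hmp, ⟨fun A hA hinv => ?_⟩⟩
  have hm : gaussMeasure.restrict A = gaussMeasure A • gaussMeasure := by
    have : IsFiniteMeasure (gaussMeasure A • gaussMeasure) :=
      ⟨by simp⟩
    refine Measure.ext_of_Iic _ _ fun t => ?_
    rw [Measure.restrict_apply measurableSet_Iic, Measure.smul_apply, smul_eq_mul, Set.inter_comm]
    have := gauss_invariant_indep hA hinv t
    rw [← ENNReal.toReal_eq_toReal_iff' (measure_ne_top _ _)
      (ENNReal.mul_ne_top (measure_ne_top _ _) (measure_ne_top _ _)), ENNReal.toReal_mul]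
    exact this
  have h2 : gaussMeasure.real A * gaussMeasure.real A = gaussMeasure.real A := by
    have := congrArg (fun ν : Measure ℝ => (ν A).toReal) hm
    simp only [Measure.restrict_apply hA, Set.inter_self, Measure.smul_apply, smul_eq_mul,
      ENNReal.toReal_mul] at this
    exact this.symm
  rw [eventuallyConst_set']
  have h3 : gaussMeasure.real A = 0 ∨ gaussMeasure.real A = 1 := by
    rcases eq_or_ne (gaussMeasure.real A) 0 with h | h
    · exact Or.inl h
    · exact Or.inr (mul_left_cancel₀ h (by rw [h2, mul_one]))
  rcases h3 with h | h
  · left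
    rw [ae_eq_empty]
    rwa [measureReal_eq_zero_iff] at h
  · right
    rw [ae_eq_univ, prob_compl_eq_zero_iff hA]
    rw [← ofReal_measureReal (measure_ne_top _ _), h, ENNReal.ofReal_one]

/-! ### Formula for the approximation constants -/

/-- Irrational points of the unit interval. -/
def Good (x : ℝ) : Prop := Irrational x ∧ 0 < x ∧ x < 1

lemma Good.gaussMap {x : ℝ} (h : Good x) : Good (gaussMap x) := by
  have hi : Irrational (_root_.gaussMap x) := by
    rw [_root_.gaussMap, Int.fract]
    exact (irrational_inv_iff.2 h.1).sub_intCast _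
  refine ⟨hi, ?_, Int.fract_lt_one _⟩
  exact lt_of_le_of_ne (Int.fract_nonneg _) (fun h0 => hi.ne_zero h0.symm)

lemma Good.iterate {x : ℝ} (h : Good x) (n : ℕ) : Good (_root_.gaussMap^[n] x) := by
  induction n with
  | zero => exact h
  | succ n ih => rw [Function.iterate_succ_apply']; exact ih.gaussMap

lemma Good.floor {x : ℝ} (h : Good x) : (1 : ℝ) ≤ (⌊x⁻¹⌋ : ℝ) := by
  have h1 : 1 ≤ x⁻¹ := (one_le_inv₀ h.2.1).2 h.2.2.le
  have : (1 : ℤ) ≤ ⌊x⁻¹⌋ := Int.le_floor.2 (by simpa using h1)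
  exact_mod_cast this

lemma natExt_iter_fst (n : ℕ) (p : ℝ × ℝ) : (natExt^[n] p).1 = gaussMap^[n] p.1 := by
  induction n with
  | zero => rfl
  | succ n ih => rw [Function.iterate_succ_apply', Function.iterate_succ_apply', natExt, ih]

lemma natExt_iter_snd_succ (n : ℕ) (p : ℝ × ℝ) : (natExt^[n + 1] p).2
    = ((⌊(gaussMap^[n] p.1)⁻¹⌋ : ℝ) + (natExt^[n] p).2)⁻¹ := by
  rw [Function.iterate_succ_apply', natExt, natExt_iter_fst]

lemma natExt_iter_snd_mem {x y : ℝ} (hx : Good x) (hy : y ∈ Set.Icc (0 : ℝ) 1) (n : ℕ) :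
    (natExt^[n] (x, y)).2 ∈ Set.Icc (0 : ℝ) 1 := by
  induction n with
  | zero => exact hy
  | succ n ih =>
    rw [natExt_iter_snd_succ]
    have h1 := (hx.iterate n).floor
    have h2 := ih.1
    simp only at h1 ⊢
    exact ⟨by positivity, inv_le_one_of_one_le₀ (by linarith)⟩

lemma inv_contract {a u v d : ℝ} (ha : 1 ≤ a) (hu : 0 ≤ u) (hv : 0 ≤ v) (hd : 0 < d)
    (h : |u - v| ≤ 1 / d) : |(a + u)⁻¹ - (a + v)⁻¹| ≤ 1 / (d + 1) := by
  have h1 : 0 < a + u := by linarith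
  have h2 : 0 < a + v := by linarith
  rw [inv_sub_inv h1.ne' h2.ne', abs_div, abs_of_pos (mul_pos h1 h2)]
  have h3 : a + v - (a + u) = -(u - v) := by ring
  rw [h3, abs_neg, div_le_div_iff₀ (by positivity) (by linarith), one_mul]
  rw [le_div_iff₀ hd] at h
  have h4 : 1 + |u - v| ≤ (a + u) * (a + v) := by
    have : |u - v| ≤ u + v := abs_le.2 ⟨by linarith, by linarith⟩
    nlinarith [mul_nonneg hu hv]
  linarith

lemma natExt_contract {x y y' : ℝ} (hx : Good x) (hy : y ∈ Set.Icc (0 : ℝ) 1)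
    (hy' : y' ∈ Set.Icc (0 : ℝ) 1) (n : ℕ) :
    |(natExt^[n] (x, y)).2 - (natExt^[n] (x, y')).2| ≤ 1 / ((n : ℝ) + 1) := by
  induction n with
  | zero =>
    simp only [Function.iterate_zero, id]
    norm_num
    exact abs_le.2 ⟨by linarith [hy.1, hy'.2], by linarith [hy'.1, hy.2]⟩
  | succ n ih =>
    rw [natExt_iter_snd_succ, natExt_iter_snd_succ]
    push_cast
    exact inv_contract (hx.iterate n).floor (natExt_iter_snd_mem hx hy n).1
      (natExt_iter_snd_mem hx hy' n).1 (by positivity) ih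

/-- The approximation constant as a function on the natural extension. -/
noncomputable def thF (p : ℝ × ℝ) : ℝ := p.1 / (1 + p.1 * p.2)

lemma thF_measurable : Measurable thF := by
  unfold thF; fun_prop

lemma thF_lip {x y y' : ℝ} (h0 : 0 < x) (h1 : x < 1) (hy : 0 ≤ y) (hy' : 0 ≤ y') :
    |thF (x, y) - thF (x, y')| ≤ |y - y'| := by
  unfold thF
  simp only
  have p1 : 1 ≤ 1 + x * y := by nlinarith
  have p2 : 1 ≤ 1 + x * y' := by nlinarith
  rw [div_sub_div _ _ (by linarith) (by linarith), abs_div,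
    abs_of_pos (by positivity : 0 < (1 + x * y) * (1 + x * y'))]
  have e : x * (1 + x * y') - (1 + x * y) * x = x ^ 2 * (y' - y) := by ring
  rw [e, abs_mul, abs_of_nonneg (sq_nonneg x), abs_sub_comm y']
  refine div_le_of_le_mul₀ (by positivity) (abs_nonneg _) ?_
  have h2 : x ^ 2 ≤ 1 := by nlinarith
  have h3 : 1 ≤ (1 + x * y) * (1 + x * y') := by nlinarith
  nlinarith [abs_nonneg (y - y')]

lemma thF_close {x y y' : ℝ} (hx : Good x) (hy : y ∈ Set.Icc (0 : ℝ) 1)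
    (hy' : y' ∈ Set.Icc (0 : ℝ) 1) (n : ℕ) :
    |thF (natExt^[n] (x, y)) - thF (natExt^[n] (x, y'))| ≤ 1 / ((n : ℝ) + 1) := by
  have e : ∀ w : ℝ, natExt^[n] (x, w) = (gaussMap^[n] x, (natExt^[n] (x, w)).2) := fun w => by
    rw [← natExt_iter_fst n (x, w)]
  rw [e y, e y']
  exact (thF_lip (hx.iterate n).2.1 (hx.iterate n).2.2 (natExt_iter_snd_mem hx hy n).1
    (natExt_iter_snd_mem hx hy' n).1).trans (natExt_contract hx hy hy' n)

lemma partQuot_cast {x : ℝ} (hx : Good x) (n : ℕ) :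
    (partQuot x (n + 1) : ℝ) = (⌊(gaussMap^[n] x)⁻¹⌋ : ℝ) := by
  have h := (hx.iterate n).floor
  have h' : (0 : ℤ) ≤ ⌊(gaussMap^[n] x)⁻¹⌋ := by
    have : (1 : ℤ) ≤ ⌊(gaussMap^[n] x)⁻¹⌋ := by exact_mod_cast h
    linarith
  rw [partQuot, Nat.add_sub_cancel]
  exact_mod_cast congrArg (fun m : ℤ => (m : ℝ)) (Int.toNat_of_nonneg h')

lemma partQuot_eq {x : ℝ} (hx : Good x) (n : ℕ) :
    (partQuot x (n + 1) : ℝ) = (gaussMap^[n] x)⁻¹ - gaussMap^[n + 1] x := by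
  rw [partQuot_cast hx, Function.iterate_succ_apply', gaussMap, Int.fract]
  ring

lemma cfQ_succ {x : ℝ} (hx : Good x) (n : ℕ) :
    (cfQ x (n + 1) : ℝ) = cfQ x n * (partQuot x (n + 1) + (natExt^[n] (x, 0)).2) := by
  induction n with
  | zero => simp [cfQ]
  | succ n ih =>
    rw [natExt_iter_snd_succ, cfQ]
    simp only
    rw [← partQuot_cast hx n]
    push_cast
    have h1 := (hx.iterate n).floor
    rw [← partQuot_cast hx n] at h1
    have h2 := (natExt_iter_snd_mem hx (y := 0) (by simp) n).1
    have h3 : (partQuot x (n + 1) + (natExt^[n] (x, 0)).2) ≠ 0 := by positivity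
    rw [mul_add, ih]
    field_simp

lemma cfQ_pos {x : ℝ} (hx : Good x) (n : ℕ) : (0 : ℝ) < cfQ x n := by
  induction n with
  | zero => simp [cfQ]
  | succ n ih =>
    rw [cfQ_succ hx]
    have h1 := (hx.iterate n).floor
    rw [← partQuot_cast hx n] at h1
    have h2 := (natExt_iter_snd_mem hx (y := 0) (by simp) n).1
    positivity

lemma cf_error {x : ℝ} (hx : Good x) (n : ℕ) :
    (cfQ x (n + 1) : ℝ) * x - cfP x (n + 1)
      = -(gaussMap^[n + 1] x) * ((cfQ x n : ℝ) * x - cfP x n) := by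
  induction n with
  | zero =>
    have h := partQuot_eq hx 0
    simp only [Function.iterate_zero, id, zero_add] at h
    have hx0 := hx.2.1.ne'
    simp only [cfQ, cfP, zero_add]
    push_cast
    rw [h]
    field_simp
    ring
  | succ n ih =>
    have h := partQuot_eq hx (n + 1)
    have h0 := (hx.iterate (n + 1)).2.1.ne'
    rw [cfQ, cfP]
    push_cast
    have e : (cfQ x n : ℝ) * x - cfP x n
        = -(gaussMap^[n + 1] x)⁻¹ * ((cfQ x (n + 1) : ℝ) * x - cfP x (n + 1)) := by
      rw [ih]
      field_simp
    rw [h]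
    linear_combination e

lemma theta_eq {x : ℝ} (hx : Good x) (n : ℕ) : theta x n = thF (natExt^[n] (x, 0)) := by
  have key : |(cfQ x n : ℝ) * x - cfP x n| * cfQ x n *
      (1 + gaussMap^[n] x * (natExt^[n] (x, 0)).2) = gaussMap^[n] x := by
    induction n with
    | zero => simp [cfQ, cfP, abs_of_pos hx.2.1]
    | succ n ih =>
      have t0 := (hx.iterate n).2.1
      have t1 := (hx.iterate (n + 1)).2.1
      have h := partQuot_eq hx n
      have h1 := (hx.iterate n).floor
      rw [← partQuot_cast hx n] at h1
      have h2 := (natExt_iter_snd_mem hx (y := 0) (by simp) n).1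
      rw [cf_error hx, abs_mul, abs_neg, abs_of_pos t1, cfQ_succ hx, natExt_iter_snd_succ]
      simp only
      rw [← partQuot_cast hx n]
      have h3 : (partQuot x (n + 1) + (natExt^[n] (x, 0)).2) ≠ 0 := by positivity
      have e : (partQuot x (n + 1) + (natExt^[n] (x, 0)).2) *
          (1 + gaussMap^[n + 1] x * (partQuot x (n + 1) + (natExt^[n] (x, 0)).2)⁻¹)
          = (gaussMap^[n] x)⁻¹ * (1 + gaussMap^[n] x * (natExt^[n] (x, 0)).2) := by
        rw [mul_add, mul_left_comm, mul_inv_cancel₀ h3, h]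
        field_simp
        ring
      calc _ = gaussMap^[n + 1] x * (|(cfQ x n : ℝ) * x - cfP x n| * cfQ x n) *
            ((partQuot x (n + 1) + (natExt^[n] (x, 0)).2) *
          (1 + gaussMap^[n + 1] x * (partQuot x (n + 1) + (natExt^[n] (x, 0)).2)⁻¹)) := by ring
        _ = gaussMap^[n + 1] x * (gaussMap^[n] x)⁻¹ * (|(cfQ x n : ℝ) * x - cfP x n| * cfQ x n *
      (1 + gaussMap^[n] x * (natExt^[n] (x, 0)).2)) := by rw [e]; ring
        _ = _ := by rw [ih]; field_simp
  have t0 := (hx.iterate n).2.1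
  have h2 := (natExt_iter_snd_mem hx (y := 0) (by simp) n).1
  have h3 : 0 < 1 + gaussMap^[n] x * (natExt^[n] (x, 0)).2 := by positivity
  rw [theta, thF, natExt_iter_fst, eq_div_iff h3.ne', mul_comm (cfQ x n : ℝ) |_|]
  exact key

lemma natExt_iter_zero {x : ℝ} (k n : ℕ) :
    natExt^[n + k] (x, 0) = natExt^[k] (gaussMap^[n] x, (natExt^[n] (x, 0)).2) := by
  rw [add_comm, Function.iterate_add_apply, ← natExt_iter_fst n (x, 0)]

lemma theta_close {x : ℝ} (hx : Good x) (k n : ℕ) :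
    |theta x (n + k) - thF (natExt^[k] (gaussMap^[n] x, 0))| ≤ 1 / ((k : ℝ) + 1) := by
  rw [theta_eq hx, natExt_iter_zero]
  exact thF_close (hx.iterate n) (natExt_iter_snd_mem hx (by simp) n) (by simp) k

/-! ### The limiting distribution -/

/-- The limiting distribution function. -/
noncomputable def limF (c : ℝ) : ℝ := (Real.log 2)⁻¹ * ∫ y in (0 : ℝ)..1, min c (1 + y)⁻¹

lemma min_continuousOn (c : ℝ) :
    ContinuousOn (fun y : ℝ => min c (1 + y)⁻¹) (Set.Icc 0 1) := by
  refine continuousOn_const.inf (ContinuousOn.inv₀ (by fun_prop) ?_)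
  intro x hx
  have := hx.1
  positivity

lemma min_intervalIntegrable (c : ℝ) :
    IntervalIntegrable (fun y : ℝ => min c (1 + y)⁻¹) volume 0 1 := by
  refine ContinuousOn.intervalIntegrable ?_
  rw [Set.uIcc_of_le zero_le_one]
  exact min_continuousOn c

lemma natMeasure_thF {c : ℝ} (hc : 0 ≤ c) :
    natMeasure {p | thF p ≤ c} = ENNReal.ofReal (limF c) := by
  have hl := log_two_inv_pos
  have hm : MeasurableSet {p | thF p ≤ c} := measurableSet_le thF_measurable measurable_const
  rw [← lintegral_indicator_one hm, lintegral_natMeasure_symm (measurable_one.indicator hm)]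
  have e : ∀ y ∈ Set.Ioo (0 : ℝ) 1, ∫⁻ x in Set.Ioo (0 : ℝ) 1,
      ENNReal.ofReal ((Real.log 2)⁻¹ * ((1 + x * y) ^ 2)⁻¹) *
        {p | thF p ≤ c}.indicator (1 : ℝ × ℝ → ENNReal) (x, y)
      = ENNReal.ofReal ((Real.log 2)⁻¹ * min c (1 + y)⁻¹) := by
    intro y hy
    have hy0 := hy.1
    have h := lintegral_theta hy.1 ((Set.Iic c).indicator 1)
    rw [lintegral_indicator_one measurableSet_Iic, Measure.restrict_apply measurableSet_Iic] at h
    have hv : volume (Set.Iic c ∩ Set.Ioo 0 (1 + y)⁻¹) = ENNReal.ofReal (min c (1 + y)⁻¹) := by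
      rcases lt_or_ge c (1 + y)⁻¹ with h1 | h1
      · have : Set.Iic c ∩ Set.Ioo 0 (1 + y)⁻¹ = Set.Ioc 0 c := by
          ext t
          simp only [Set.mem_inter_iff, Set.mem_Iic, Set.mem_Ioo, Set.mem_Ioc]
          constructor
          · rintro ⟨a, b, _⟩; exact ⟨b, a⟩
          · rintro ⟨a, b⟩; exact ⟨b, a, by linarith⟩
        rw [this, Real.volume_Ioc, sub_zero, min_eq_left h1.le]
      · have : Set.Iic c ∩ Set.Ioo 0 (1 + y)⁻¹ = Set.Ioo 0 (1 + y)⁻¹ := by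
          refine Set.inter_eq_right.2 fun t ht => ?_
          exact (ht.2.trans_le h1).le
        rw [this, Real.volume_Ioo, sub_zero, min_eq_right h1]
    rw [hv] at h
    rw [ENNReal.ofReal_mul hl.le, ← h, ← lintegral_const_mul]
    · refine lintegral_congr fun x => ?_
      rw [ENNReal.ofReal_mul hl.le, mul_assoc]
      rfl
    · exact Measurable.mul (by fun_prop)
        ((measurable_one.indicator measurableSet_Iic).comp (by fun_prop))
  rw [setLIntegral_congr_fun measurableSet_Ioo e, ← ofReal_integral_eq_lintegral_ofReal]
  · rw [← integral_Ioc_eq_integral_Ioo, ← intervalIntegral.integral_of_le zero_le_one,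
      intervalIntegral.integral_const_mul, limF]
  · exact ((continuousOn_const.mul (min_continuousOn c)).integrableOn_Icc).mono_set
      Set.Ioo_subset_Icc_self
  · filter_upwards [ae_restrict_mem measurableSet_Ioo] with x hx
    have := hx.1
    simp only [Pi.zero_apply]
    have h2 : 0 ≤ min c (1 + x)⁻¹ := le_min hc (by positivity)
    positivity

lemma limF_mono {c c' : ℝ} (h : c ≤ c') : limF c ≤ limF c' := by
  refine mul_le_mul_of_nonneg_left ?_ log_two_inv_pos.le
  refine intervalIntegral.integral_mono_on zero_le_one (min_intervalIntegrable c)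
    (min_intervalIntegrable c') fun y _ => ?_
  exact min_le_min_right _ h

lemma limF_lip (c : ℝ) {d : ℝ} (hd : 0 ≤ d) : limF (c + d) ≤ limF c + (Real.log 2)⁻¹ * d := by
  unfold limF
  rw [← mul_add]
  refine mul_le_mul_of_nonneg_left ?_ log_two_inv_pos.le
  have h : ∫ y in (0 : ℝ)..1, min (c + d) (1 + y)⁻¹
      ≤ ∫ y in (0 : ℝ)..1, (min c (1 + y)⁻¹ + d) := by
    refine intervalIntegral.integral_mono_on zero_le_one (min_intervalIntegrable _)
      ((min_intervalIntegrable c).add intervalIntegrable_const) fun y _ => ?_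
    rcases le_total c (1 + y)⁻¹ with h | h
    · rw [min_eq_left h]; exact min_le_left _ _
    · rw [min_eq_right h]; exact (min_le_right _ _).trans (by linarith)
  rw [intervalIntegral.integral_add (min_intervalIntegrable c) intervalIntegrable_const] at h
  simpa using h

lemma limF_nonneg {c : ℝ} (hc : 0 ≤ c) : 0 ≤ limF c := by
  refine mul_nonneg log_two_inv_pos.le (intervalIntegral.integral_nonneg zero_le_one fun y hy => ?_)
  have := hy.1
  exact le_min hc (by positivity)

lemma limF_low {z : ℝ} (h1 : z ≤ 1 / 2) : limF z = z / Real.log 2 := by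
  have : ∫ y in (0 : ℝ)..1, min z (1 + y)⁻¹ = ∫ y in (0 : ℝ)..1, z := by
    refine intervalIntegral.integral_congr fun y hy => ?_
    rw [Set.uIcc_of_le zero_le_one] at hy
    have h0 := hy.1
    refine min_eq_left (h1.trans ?_)
    rw [← one_div]
    exact one_div_le_one_div_of_le (by positivity) (by linarith [hy.2])
  rw [limF, this]
  simp
  field_simp

lemma limF_high {z : ℝ} (h1 : 1 / 2 ≤ z) (h2 : z ≤ 1) :
    limF z = (1 - z + Real.log (2 * z)) / Real.log 2 := by
  have hz : 0 < z := by linarith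
  set b := (1 - z) / z with hb
  have hb0 : 0 ≤ b := div_nonneg (by linarith) hz.le
  have hb1 : b ≤ 1 := by rw [hb, div_le_one hz]; linarith
  have hb2 : 1 + b = z⁻¹ := by rw [hb]; field_simp; ring
  have hi := min_intervalIntegrable z
  have i1 : IntervalIntegrable (fun y : ℝ => min z (1 + y)⁻¹) volume 0 b :=
    hi.mono_set (by rw [Set.uIcc_of_le hb0, Set.uIcc_of_le zero_le_one]; exact Set.Icc_subset_Icc le_rfl hb1)
  have i2 : IntervalIntegrable (fun y : ℝ => min z (1 + y)⁻¹) volume b 1 :=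
    hi.mono_set (by rw [Set.uIcc_of_le hb1, Set.uIcc_of_le zero_le_one]; exact Set.Icc_subset_Icc hb0 le_rfl)
  have e1 : ∫ y in (0 : ℝ)..b, min z (1 + y)⁻¹ = ∫ y in (0 : ℝ)..b, z := by
    refine intervalIntegral.integral_congr fun y hy => ?_
    rw [Set.uIcc_of_le hb0] at hy
    have h0 := hy.1
    refine min_eq_left ?_
    rw [le_inv_comm₀ hz (by positivity), ← hb2]
    linarith [hy.2]
  have e2 : ∫ y in b..1, min z (1 + y)⁻¹ = ∫ y in b..1, (1 + y)⁻¹ := by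
    refine intervalIntegral.integral_congr fun y hy => ?_
    rw [Set.uIcc_of_le hb1] at hy
    have h0 := hy.1
    refine min_eq_right ?_
    rw [inv_le_comm₀ (by linarith) hz, ← hb2]
    linarith
  rw [limF, ← intervalIntegral.integral_add_adjacent_intervals i1 i2, e1, e2,
    integral_inv_one_add b (by linarith) hb1, hb2, intervalIntegral.integral_const, div_inv_eq_mul]
  have e3 : (b - 0) • z = 1 - z := by
    rw [hb, sub_zero, smul_eq_mul, div_mul_cancel₀ _ hz.ne']
  rw [e3, mul_comm, div_eq_mul_inv]

/-- The `k`-step approximation to `θ`. -/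
noncomputable def approxTheta (k : ℕ) (x : ℝ) : ℝ := thF (natExt^[k] (x, 0))

lemma approxTheta_measurable (k : ℕ) : Measurable (approxTheta k) :=
  thF_measurable.comp ((natExt_measurable.iterate k).comp (by fun_prop))

lemma ae_nat_good : ∀ᵐ p ∂natMeasure, Good p.1 ∧ p.2 ∈ Set.Icc (0 : ℝ) 1 := by
  have h1 : ∀ᵐ p ∂natMeasure, Good p.1 :=
    fst_measurePreserving.quasiMeasurePreserving.ae ae_gauss_good
  have h2 : ∀ᵐ p ∂natMeasure, p.2 ∈ Set.Icc (0 : ℝ) 1 := by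
    refine (withDensity_absolutelyContinuous _ _).ae_le ?_
    rw [Measure.prod_restrict]
    filter_upwards [ae_restrict_mem (measurableSet_Ioo.prod measurableSet_Ioo)] with p hp
    exact ⟨hp.2.1.le, hp.2.2.le⟩
  exact h1.and h2

lemma approx_sets (k : ℕ) (c : ℝ) :
    gaussMeasure {x | approxTheta k x ≤ c} = natMeasure {p | approxTheta k p.1 ≤ c} := by
  have hm : MeasurableSet {x | approxTheta k x ≤ c} :=
    measurableSet_le (approxTheta_measurable k) measurable_const
  rw [← fst_measurePreserving.measure_preimage hm.nullMeasurableSet]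
  rfl

lemma natExt_iter_measure (k : ℕ) (c : ℝ) :
    natMeasure {p | thF (natExt^[k] p) ≤ c} = natMeasure {p | thF p ≤ c} := by
  have hm : MeasurableSet {p | thF p ≤ c} := measurableSet_le thF_measurable measurable_const
  rw [← (natExt_measurePreserving.iterate k).measure_preimage hm.nullMeasurableSet]
  rfl

lemma approx_upper (k : ℕ) {c : ℝ} (hc : 0 ≤ c) :
    gaussMeasure.real {x | approxTheta k x ≤ c} ≤ limF (c + 1 / ((k : ℝ) + 1)) := by
  have hc' : 0 ≤ c + 1 / ((k : ℝ) + 1) := by positivity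
  refine ENNReal.toReal_le_of_le_ofReal (limF_nonneg hc') ?_
  rw [approx_sets, ← natMeasure_thF hc', ← natExt_iter_measure k]
  refine measure_mono_ae ?_
  filter_upwards [ae_nat_good] with p hp h
  have h1 := thF_close hp.1 hp.2 (y' := 0) (by simp) k
  have h2 : thF (natExt^[k] (p.1, 0)) ≤ c := h
  have h3 := (abs_le.1 h1).2
  change thF (natExt^[k] (p.1, p.2)) ≤ _
  linarith

lemma approx_lower (k : ℕ) {c : ℝ} (hc : 0 ≤ c - 1 / ((k : ℝ) + 1)) :
    limF (c - 1 / ((k : ℝ) + 1)) ≤ gaussMeasure.real {x | approxTheta k x ≤ c} := by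
  rw [Measure.real, ← ENNReal.ofReal_le_iff_le_toReal (measure_ne_top _ _)]
  rw [approx_sets, ← natMeasure_thF hc, ← natExt_iter_measure k]
  refine measure_mono_ae ?_
  filter_upwards [ae_nat_good] with p hp h
  have h1 := thF_close hp.1 hp.2 (y' := 0) (by simp) k
  have h2 : thF (natExt^[k] (p.1, p.2)) ≤ c - 1 / ((k : ℝ) + 1) := h
  have h3 := (abs_le.1 h1).1
  change thF (natExt^[k] (p.1, 0)) ≤ _
  linarith

/-! ### Counting -/

/-- The counting function of the theorem. -/
noncomputable def cnt (x z : ℝ) (n : ℕ) : ℕ := {i : ℕ | 1 ≤ i ∧ i ≤ n ∧ theta x i ≤ z}.ncard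

open Classical in
lemma cnt_eq (x z : ℝ) (n : ℕ) :
    cnt x z n = ((Finset.Icc 1 n).filter fun i => theta x i ≤ z).card := by
  rw [cnt, ← Set.ncard_coe_finset]
  congr 1
  ext i
  simp [and_assoc]

open Classical in
lemma bsum_eq (x c : ℝ) (k n : ℕ) :
    birkhoffSum gaussMap ({x | approxTheta k x ≤ c}.indicator (1 : ℝ → ℝ)) n x
      = (((Finset.range n).filter fun j => approxTheta k (gaussMap^[j] x) ≤ c).card : ℝ) := by
  rw [birkhoffSum, Finset.card_filter]
  push_cast
  refine Finset.sum_congr rfl fun j _ => ?_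
  by_cases h : approxTheta k (gaussMap^[j] x) ≤ c
  · rw [if_pos h, Set.indicator_of_mem (by exact h)]; rfl
  · rw [if_neg h, Set.indicator_of_notMem (by exact h)]

lemma cnt_le {x z c : ℝ} (hx : Good x) {k : ℕ} (hk : 1 ≤ k) (hc : z + 1 / ((k : ℝ) + 1) ≤ c) (n : ℕ) :
    (cnt x z n : ℝ) ≤ (k + 1 : ℕ) +
      birkhoffSum gaussMap ({x | approxTheta k x ≤ c}.indicator (1 : ℝ → ℝ)) n x := by
  classical
  rw [cnt_eq, bsum_eq]
  norm_cast
  have hsub : ((Finset.Icc 1 n).filter fun i => theta x i ≤ z) ⊆ Finset.range (k + 1) ∪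
      ((Finset.range n).filter fun j => approxTheta k (gaussMap^[j] x) ≤ c).image (· + k) := by
    intro i hi
    simp only [Finset.mem_filter, Finset.mem_Icc] at hi
    rw [Finset.mem_union]
    by_cases hik : i ≤ k
    · left; simp; omega
    · right
      obtain ⟨j, rfl⟩ : ∃ j, i = j + k := ⟨i - k, by omega⟩
      refine Finset.mem_image.2 ⟨j, ?_, rfl⟩
      rw [Finset.mem_filter, Finset.mem_range]
      refine ⟨by omega, ?_⟩
      have h1 := (abs_le.1 (theta_close hx k j)).1
      rw [approxTheta]
      linarith [hi.2]
  refine (Finset.card_le_card hsub).trans ((Finset.card_union_le _ _).trans ?_)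
  rw [Finset.card_range]
  exact Nat.add_le_add_left Finset.card_image_le _

lemma le_cnt {x z c : ℝ} (hx : Good x) {k : ℕ} (hk : 1 ≤ k) (hc : c + 1 / ((k : ℝ) + 1) ≤ z) (n : ℕ) :
    birkhoffSum gaussMap ({x | approxTheta k x ≤ c}.indicator (1 : ℝ → ℝ)) n x
      ≤ cnt x z n + (k + 1 : ℕ) := by
  classical
  rw [cnt_eq, bsum_eq]
  norm_cast
  have hsub : ((Finset.range n).filter fun j => approxTheta k (gaussMap^[j] x) ≤ c).image (· + k) ⊆
      ((Finset.Icc 1 n).filter fun i => theta x i ≤ z) ∪ Finset.Icc (n + 1) (n + k) := by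
    intro i hi
    obtain ⟨j, hj, rfl⟩ := Finset.mem_image.1 hi
    rw [Finset.mem_filter, Finset.mem_range] at hj
    rw [Finset.mem_union]
    by_cases hik : j + k ≤ n
    · left
      rw [Finset.mem_filter, Finset.mem_Icc]
      refine ⟨by omega, ?_⟩
      have h1 := (abs_le.1 (theta_close hx k j)).2
      have h2 := hj.2
      rw [approxTheta] at h2
      linarith
    · right
      simp only [Finset.mem_Icc]
      omega
  have := (Finset.card_le_card hsub).trans (Finset.card_union_le _ _)
  rw [Finset.card_image_of_injective _ (add_left_injective k), Nat.card_Icc] at this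
  omega

lemma cnt_tendsto {x : ℝ} (hx : Good x)
    (hb : ∀ (k : ℕ) (c : ℚ), Tendsto (fun n : ℕ =>
      birkhoffSum gaussMap ({x | approxTheta k x ≤ c}.indicator (1 : ℝ → ℝ)) n x / n) atTop
      (𝓝 (gaussMeasure.real {x | approxTheta k x ≤ c}))) {z : ℝ} (hz : 0 < z) :
    Tendsto (fun n : ℕ => (cnt x z n : ℝ) / n) atTop (𝓝 (limF z)) := by
  have hl := log_two_inv_pos
  rw [Metric.tendsto_nhds]
  intro ε hε
  have hη : 0 < min (z / 3) (ε / (6 * (Real.log 2)⁻¹)) := by positivity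
  obtain ⟨k', hk'⟩ := exists_nat_one_div_lt hη
  set k := k' + 1 with hkdef
  have hk1 : 1 ≤ k := by omega
  set d := 1 / ((k : ℝ) + 1) with hd
  have hd0 : 0 < d := by positivity
  have hdk : d ≤ 1 / ((k' : ℝ) + 1) := by
    rw [hd, hkdef]
    push_cast
    exact one_div_le_one_div_of_le (by positivity) (by linarith)
  have hdz : 3 * d < z := by
    have := (hdk.trans_lt hk').trans_le (min_le_left _ _)
    linarith
  have hde : (Real.log 2)⁻¹ * (3 * d) < ε / 2 := by
    have := (hdk.trans_lt hk').trans_le (min_le_right _ _)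
    rw [lt_div_iff₀ (by positivity)] at this
    linarith
  obtain ⟨c1, hc1, hc1'⟩ := exists_rat_btwn (show z + d < z + 2 * d by linarith)
  obtain ⟨c2, hc2, hc2'⟩ := exists_rat_btwn (show z - 2 * d < z - d by linarith)
  have hK : Tendsto (fun n : ℕ => ((k + 1 : ℕ) : ℝ) / n) atTop (𝓝 0) :=
    tendsto_const_nhds.div_atTop tendsto_natCast_atTop_atTop
  have u1 : gaussMeasure.real {x | approxTheta k x ≤ c1} ≤ limF z + (Real.log 2)⁻¹ * (3 * d) := by
    refine (approx_upper k (by linarith)).trans ((limF_mono ?_).trans (limF_lip z (by linarith)))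
    linarith
  have u2 : limF z - (Real.log 2)⁻¹ * (3 * d) ≤ gaussMeasure.real {x | approxTheta k x ≤ c2} := by
    have h1 := approx_lower k (c := c2) (by rw [← hd]; linarith)
    have h2 := limF_lip (c2 - d) (d := 3 * d) (by linarith)
    have h3 : limF z ≤ limF (c2 - d + 3 * d) := limF_mono (by linarith)
    rw [← hd] at h1
    linarith
  have t1 := (hK.add (hb k c1)).eventually_lt_const
    (show 0 + gaussMeasure.real {x | approxTheta k x ≤ c1} < limF z + ε by linarith)
  have t2 := ((hb k c2).sub hK).eventually_const_lt
    (show limF z - ε < gaussMeasure.real {x | approxTheta k x ≤ c2} - 0 by linarith)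
  filter_upwards [t1, t2] with n h1 h2
  have g1 := div_le_div_of_nonneg_right (cnt_le hx hk1 (c := c1) hc1.le n) (Nat.cast_nonneg n)
  have g2 := div_le_div_of_nonneg_right (le_cnt hx hk1 (c := c2) (z := z) (by linarith) n)
    (Nat.cast_nonneg n)
  rw [add_div] at g1 g2
  rw [Real.dist_eq, abs_lt]
  constructor <;> linarith

/-- For almost every `x ∈ (0,1)`, the approximation constants `θₙ(x)` have the limiting
distribution `F`: for every `z ∈ (0,1]`,
`(1/n)·#{1 ≤ i ≤ n : θᵢ(x) ≤ z} → F(z)`, where `F(z) = z/log 2` for `0 < z ≤ 1/2` and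
`F(z) = (1 − z + log(2z))/log 2` for `1/2 ≤ z ≤ 1`. -/
theorem theta_limiting_distribution :
    ∀ᵐ x ∂(volume.restrict (Set.Ioo (0 : ℝ) 1)),
      ∀ z : ℝ, 0 < z → z ≤ 1 →
        (z ≤ 1 / 2 →
          Tendsto (fun n : ℕ =>
              (({i : ℕ | 1 ≤ i ∧ i ≤ n ∧ theta x i ≤ z}.ncard : ℝ) / n)) atTop
            (𝓝 (z / Real.log 2))) ∧
        (1 / 2 ≤ z →
          Tendsto (fun n : ℕ =>
              (({i : ℕ | 1 ≤ i ∧ i ≤ n ∧ theta x i ≤ z}.ncard : ℝ) / n)) atTop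
            (𝓝 ((1 - z + Real.log (2 * z)) / Real.log 2))) := by
  have hb : ∀ᵐ x ∂gaussMeasure, ∀ (k : ℕ) (c : ℚ), Tendsto (fun n : ℕ =>
      birkhoffSum gaussMap ({x | approxTheta k x ≤ c}.indicator (1 : ℝ → ℝ)) n x / n) atTop
      (𝓝 (gaussMeasure.real {x | approxTheta k x ≤ c})) := by
    rw [ae_all_iff]
    intro k
    rw [ae_all_iff]
    intro c
    have hm : MeasurableSet {x | approxTheta k x ≤ c} :=
      measurableSet_le (approxTheta_measurable k) measurable_const
    rw [← integral_indicator_one hm]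
    refine birkhoff_bounded gauss_ergodic (measurable_one.indicator hm) (C := 1) fun x => ?_
    by_cases h : x ∈ {x | approxTheta k x ≤ c}
    · rw [Set.indicator_of_mem h]; simp
    · rw [Set.indicator_of_notMem h]; simp
  refine ae_of_ae_gauss ?_
  filter_upwards [hb, ae_gauss_good] with x hx hg z hz0 hz1
  have h := cnt_tendsto hg hx hz0
  refine ⟨fun h1 => ?_, fun h1 => ?_⟩
  · rw [← limF_low h1]; exact h
  · rw [← limF_high h1 hz1]; exact h
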